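/- In S(F₃;ℂ), with γ = g₂g₁⁻¹g₃g₁g₃⁻¹ and δ = g₁⁻¹g₃g₁g₃⁻¹g₂, one has Φ(Q) = [γg₁g₃] − [δg₁g₃], where Q = x₁²x₁₂₃ − x₃²x₁₂₃ − x₁³x₂₃ + x₃³x₁₂ − x₁x₁₂x₁₃ + x₃x₁₃x₂₃ + 2x₁x₂₃ − 2x₃x₁₂ − x₁x₁₃²x₂₃ + x₃x₁₂x₁₃² + x₁²x₃x₁₂ − x₁x₃²x₂₃ + x₁²x₃x₁₃x₂₃ − x₁x₃²x₁₂x₁₃. -/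

import Mathlib

open MvPolynomial

noncomputable section

def skeinIdeal (R G : Type*) [CommRing R] [Group G] : Ideal (MvPolynomial G R) :=
  Ideal.span ({X (1 : G) - 2} ∪
    {p | ∃ g h : G, p = X g * X h - X (g * h) - X (g * h⁻¹)})

abbrev SkeinAlgebra (R G : Type*) [CommRing R] [Group G] :=
  MvPolynomial G R ⧸ skeinIdeal R G

def cl (R : Type*) {G : Type*} [CommRing R] [Group G] (g : G) : SkeinAlgebra R G :=
  Ideal.Quotient.mk (skeinIdeal R G) (X g)

/-- The free group on three generators. -/
abbrev F3 := FreeGroup (Fin 3)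

def g1 : F3 := FreeGroup.of 0
def g2 : F3 := FreeGroup.of 1
def g3 : F3 := FreeGroup.of 2

/-- The words `g₁, g₂, g₃, g₁g₂, g₁g₃, g₂g₃, g₁g₂g₃` indexed by the seven variables
`x₁, x₂, x₃, x₁₂, x₁₃, x₂₃, x₁₂₃`. -/
def word : Fin 7 → F3 := ![g1, g2, g3, g1 * g2, g1 * g3, g2 * g3, g1 * g2 * g3]

/-- `Φ : ℂ[x₁,…,x₁₂₃] → S(F₃;ℂ)`, `x_{i₁⋯i_k} ↦ [g_{i₁}⋯g_{i_k}]`. -/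
def Phi : MvPolynomial (Fin 7) ℂ →ₐ[ℂ] SkeinAlgebra ℂ F3 :=
  aeval fun i => cl ℂ (word i)

-- the seven variables
def x1 : MvPolynomial (Fin 7) ℂ := X 0
def x2 : MvPolynomial (Fin 7) ℂ := X 1
def x3 : MvPolynomial (Fin 7) ℂ := X 2
def x12 : MvPolynomial (Fin 7) ℂ := X 3
def x13 : MvPolynomial (Fin 7) ℂ := X 4
def x23 : MvPolynomial (Fin 7) ℂ := X 5
def x123 : MvPolynomial (Fin 7) ℂ := X 6

/-- The polynomial `K`. -/
def K : MvPolynomial (Fin 7) ℂ :=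
  x123 ^ 2 - (x12 * x3 + x13 * x2 + x23 * x1 - x1 * x2 * x3) * x123
    + x1 ^ 2 + x2 ^ 2 + x3 ^ 2 + x12 ^ 2 + x23 ^ 2 + x13 ^ 2
    - x1 * x2 * x12 - x1 * x3 * x13 - x2 * x3 * x23 + x12 * x13 * x23 - 4

def rgamma : F3 := g2 * g1⁻¹ * g3 * g1 * g3⁻¹
def rdelta : F3 := g1⁻¹ * g3 * g1 * g3⁻¹ * g2

def Q : MvPolynomial (Fin 7) ℂ :=
  x1^2*x123 - x3^2*x123 - x1^3*x23 + x3^3*x12 - x1*x12*x13 + x3*x13*x23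
    + 2*x1*x23 - 2*x3*x12 - x1*x13^2*x23 + x3*x12*x13^2 + x1^2*x3*x12
    - x1*x3^2*x23 + x1^2*x3*x13*x23 - x1*x3^2*x12*x13

section SkeinRelations

variable {R G : Type*} [CommRing R] [Group G]

theorem cl_one : cl R (1 : G) = 2 := by
  have h : (X (1 : G) - 2 : MvPolynomial G R) ∈ skeinIdeal R G :=
    Ideal.subset_span (Or.inl rfl)
  have h' := Ideal.Quotient.eq_zero_iff_mem.mpr h
  rw [map_sub, map_ofNat] at h'
  exact sub_eq_zero.mp h'

theorem cl_mul_cl (g h : G) : cl R g * cl R h = cl R (g * h) + cl R (g * h⁻¹) := by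
  have hm : (X g * X h - X (g * h) - X (g * h⁻¹) : MvPolynomial G R) ∈ skeinIdeal R G :=
    Ideal.subset_span (Or.inr ⟨g, h, rfl⟩)
  have h' := Ideal.Quotient.eq_zero_iff_mem.mpr hm
  rw [map_sub, map_sub, map_mul] at h'
  unfold cl
  linear_combination h'

theorem cl_inv (g : G) : cl R g⁻¹ = cl R g := by
  have h := cl_mul_cl (R := R) 1 g
  rw [cl_one, one_mul, one_mul] at h
  linear_combination -h

theorem cl_mul_comm (g h : G) : cl R (g * h) = cl R (h * g) := by
  have h₁ := cl_mul_cl (R := R) g h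
  have h₂ := cl_mul_cl (R := R) h g
  have h₃ := cl_inv (R := R) (g * h⁻¹)
  rw [mul_inv_rev, inv_inv] at h₃
  linear_combination h₂ - h₁ + h₃

theorem cl_mul_inv_mul (u g v : G) :
    cl R (u * g⁻¹ * v) = cl R g * cl R (u * v) - cl R (u * g * v) := by
  have h := cl_mul_cl (R := R) (v * u) g
  rw [cl_mul_comm v u] at h
  rw [cl_mul_comm (u * g⁻¹) v, cl_mul_comm (u * g) v, ← mul_assoc, ← mul_assoc]
  linear_combination -h

/-- The Cayley–Hamilton relation in the skein algebra. -/
theorem cl_mul_sq_mul (u g v : G) :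
    cl R (u * g * g * v) = cl R g * cl R (u * g * v) - cl R (u * v) := by
  have h := cl_mul_inv_mul (R := R) (u * g) g v
  rw [mul_inv_cancel_right] at h
  linear_combination h

theorem cl_mul_add_cl_mul_swap (u g h : G) :
    cl R (u * g * h) + cl R (u * h * g) = cl R g * cl R (u * h) + cl R h * cl R (u * g)
      + (cl R (g * h) - cl R g * cl R h) * cl R u := by
  have h₁ := cl_mul_cl (R := R) (u * g) h
  have h₂ := cl_mul_cl (R := R) (u * h) g
  have h₃ := cl_mul_cl (R := R) u (g * h⁻¹)
  have h₄ := cl_mul_cl (R := R) g h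
  rw [mul_inv_rev, inv_inv, ← mul_assoc, ← mul_assoc] at h₃
  linear_combination -h₁ - h₂ + h₃ + cl R u * h₄

/-- The word `b a⁻¹ c a c⁻¹ a c` reduced to words in which `a` and `c` occur at most once. -/
theorem cl_gamma_word (a b c : G) :
    cl R (b * a⁻¹ * c * a * c⁻¹ * a * c) =
      (cl R c * cl R a - cl R (a * c)) *
          (cl R (a * c) * cl R (b * a⁻¹ * c) - cl R (b * a⁻¹ * a⁻¹))
        - cl R c * (cl R c * cl R (b * a⁻¹ * c) - cl R (b * a⁻¹)) + cl R (b * a⁻¹ * c) := by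
  have h₁ := cl_mul_inv_mul (R := R) (b * a⁻¹ * c * a) c (a * c)
  have h₂ := cl_mul_sq_mul (R := R) (b * a⁻¹ * c) a c
  have h₃ := cl_mul_sq_mul (R := R) (b * a⁻¹) (c * a) c
  have h₄ := cl_mul_sq_mul (R := R) (b * a⁻¹) c 1
  have h₅ := cl_mul_sq_mul (R := R) (b * a⁻¹ * a⁻¹) (a * c) 1
  rw [cl_mul_comm c a] at h₃
  simp only [mul_assoc, inv_mul_cancel_left, mul_one] at h₁ h₂ h₃ h₄ h₅ ⊢
  rw [h₁, h₂, h₃, h₄, h₅]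
  ring

/-- The word `b a c a⁻¹ c a c⁻¹` reduced to words in which `a` and `c` occur at most once. -/
theorem cl_delta_word (a b c : G) :
    cl R (b * a * c * a⁻¹ * c * a * c⁻¹) =
      cl R c * ((cl R a * cl R c - cl R (a * c)) *
            (cl R (a * c) * cl R (b * a) - cl R (b * c⁻¹))
          - cl R a * (cl R a * cl R (b * a) - cl R b) + cl R (b * a))
        - ((cl R a * cl R c - cl R (a * c)) * (cl R (a * c) * cl R (b * a * c) - cl R b)
          - cl R a * (cl R a * cl R (b * a * c) - cl R (b * c)) + cl R (b * a * c)) := by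
  have h₁ := cl_mul_inv_mul (R := R) (b * a * c * a⁻¹ * c * a) c 1
  have h₂ := cl_mul_inv_mul (R := R) (b * a * c) a (c * a)
  have h₃ := cl_mul_sq_mul (R := R) (b * a) c a
  have h₄ := cl_mul_sq_mul (R := R) b a 1
  have h₅ := cl_mul_sq_mul (R := R) b (a * c) a
  have h₆ := cl_mul_sq_mul (R := R) b (a * c) c⁻¹
  have h₇ := cl_mul_inv_mul (R := R) (b * a * c) a (c * a * c)
  have h₈ := cl_mul_sq_mul (R := R) (b * a) c (a * c)
  have h₉ := cl_mul_sq_mul (R := R) b a c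
  have h₁₀ := cl_mul_sq_mul (R := R) b (a * c) 1
  have h₁₁ := cl_mul_sq_mul (R := R) b (a * c) (a * c)
  simp only [mul_assoc, mul_inv_cancel, mul_one] at h₁ h₂ h₃ h₄ h₅ h₆ h₇ h₈ h₉ h₁₀ h₁₁ ⊢
  rw [h₁, h₂, h₃, h₄, h₅, h₆, h₇, h₈, h₉, h₁₁, h₁₀]
  ring

end SkeinRelations

theorem phi_Q_gamma_g1g3 : Phi Q = cl ℂ (rgamma * g1 * g3) - cl ℂ (rdelta * g1 * g3) := by
  have hδ : cl ℂ (rdelta * g1 * g3) = cl ℂ (g2 * g1 * g3 * g1⁻¹ * g3 * g1 * g3⁻¹) := by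
    have h := cl_mul_comm (R := ℂ) (g1⁻¹ * g3 * g1 * g3⁻¹) (g2 * g1 * g3)
    simpa only [rdelta, mul_assoc] using h
  have h₁ := cl_mul_inv_mul (R := ℂ) g2 g1 g3
  have h₂ := cl_mul_inv_mul (R := ℂ) g2 g1 1
  have h₃ := cl_mul_inv_mul (R := ℂ) (g2 * g1⁻¹) g1 1
  have h₄ := cl_mul_inv_mul (R := ℂ) g2 g3 1
  have h₅ := cl_mul_add_cl_mul_swap (R := ℂ) g3 g1 g2
  simp only [mul_one, inv_mul_cancel_right] at h₂ h₃ h₄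
  rw [mul_assoc g3 g1 g2, cl_mul_comm g3 (g1 * g2), mul_assoc g3 g2 g1,
    cl_mul_comm g3 (g2 * g1), cl_mul_comm g3 g2, cl_mul_comm g3 g1] at h₅
  rw [hδ, rgamma, cl_gamma_word, cl_delta_word, h₁, h₃, h₂, h₄, cl_mul_comm g2 g1,
    eq_sub_of_add_eq' h₅]
  simp only [Q, x1, x3, x12, x13, x23, x123, Phi, map_add, map_sub, map_mul, map_pow,
    map_ofNat, aeval_X, word, Matrix.cons_val]
  ring
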